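/- arXiv:1802.01418 — 2 statements merged into one kernel-verified Lean document; each statement's English description precedes it below -/
import Mathlib

section
/- Let T(x, y) = (x + y, y) on 𝕋² with Lebesgue measure and invariant σ-algebra I. If f₁ and f₂ are real-analytic on 𝕋², then there exist constants c, C > 0 such that for all n ∈ ℤ: |E(f̄₁ · f₂∘Tⁿ) − E(E(f̄₁|I)E(f₂|I))| ≤ C e^{−c|n|}. -/
open MeasureTheory Filter Set
open scoped ENNReal Topology

/-- Cauchy estimates near a point of analyticity. -/
theorem HasFPowerSeriesOnBall.eventually_norm_iteratedFDeriv_le {E F : Type*}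
    [NormedAddCommGroup E] [NormedSpace ℝ E] [NormedAddCommGroup F] [NormedSpace ℝ F]
    [CompleteSpace F] {f : E → F} {p : FormalMultilinearSeries ℝ E F} {x : E} {r : ℝ≥0∞}
    (hf : HasFPowerSeriesOnBall f p x r) :
    ∃ M R : ℝ, 0 ≤ M ∧ 0 ≤ R ∧
      ∀ᶠ z in 𝓝 x, ∀ k : ℕ, ‖iteratedFDeriv ℝ k f z‖ ≤ M * k.factorial * R ^ k := by
  obtain ⟨a, ha0, har⟩ := ENNReal.lt_iff_exists_nnreal_btwn.1 hf.r_pos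
  have ha0' : (0 : NNReal) < a := by exact_mod_cast ha0
  have hsum : ((a / 2 : NNReal) : ℝ≥0∞) + ((a / 2 : NNReal) : ℝ≥0∞) < p.radius := by
    rw [← ENNReal.coe_add, add_halves]
    exact har.trans_le hf.r_le
  have hS := p.changeOriginSeries_summable_aux₁ hsum
  generalize hb : a / 2 = b at hsum hS
  have hb0 : 0 < b := hb ▸ half_pos ha0'
  set S : NNReal := ∑' s : Σ k l : ℕ, { s : Finset (Fin (k + l)) // s.card = l },
    ‖p (s.1 + s.2.1)‖₊ * b ^ s.2.1 * b ^ s.1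
  refine ⟨S, (b : ℝ)⁻¹, S.2, by positivity, ?_⟩
  filter_upwards [Metric.ball_mem_nhds x (NNReal.coe_pos.2 hb0)] with z hz k
  set y := z - x with hy
  have hyb : ‖y‖₊ < b := by
    rw [← NNReal.coe_lt_coe, coe_nnnorm, hy, ← dist_eq_norm]; exact hz
  have hba : (b : ℝ≥0∞) < r := lt_of_le_of_lt (by rw [← hb]; exact_mod_cast NNReal.half_le_self a) har
  have hyr : (‖y‖₊ : ℝ≥0∞) < r := lt_trans (by exact_mod_cast hyb) hba
  have hser := hf.changeOrigin hyr
  rw [show x + y = z by simp [hy]] at hser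
  have hk : ‖p.changeOrigin y k‖₊ * b ^ k ≤ S := by
    have h1 := p.nnnorm_changeOrigin_le k (hyr.trans_le hf.r_le)
    have hsk := p.changeOriginSeries_summable_aux₂ (hba.trans_le hf.r_le) k
    calc ‖p.changeOrigin y k‖₊ * b ^ k
        ≤ (∑' s : Σ l : ℕ, { s : Finset (Fin (k + l)) // s.card = l },
            ‖p (k + s.1)‖₊ * b ^ s.1) * b ^ k := by
          gcongr
          refine h1.trans ?_
          have hle : ∀ s : Σ l : ℕ, { s : Finset (Fin (k + l)) // s.card = l },
              ‖p (k + s.1)‖₊ * ‖y‖₊ ^ s.1 ≤ ‖p (k + s.1)‖₊ * b ^ s.1 :=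
            fun s => mul_le_mul' le_rfl (pow_le_pow_left' hyb.le _)
          exact (NNReal.summable_of_le hle hsk).tsum_le_tsum hle hsk
      _ = ∑' s : Σ l : ℕ, { s : Finset (Fin (k + l)) // s.card = l },
            ‖p (k + s.1)‖₊ * b ^ s.1 * b ^ k := by rw [NNReal.tsum_mul_right]
      _ ≤ S := by
          exact le_hasSum (hS.hasSum.sigma fun k => ((NNReal.summable_sigma.1 hS).1 k).hasSum) k
            fun _ _ => zero_le
  have hk' : ‖p.changeOrigin y k‖ ≤ S * (b : ℝ)⁻¹ ^ k := by
    rw [inv_pow, ← div_eq_mul_inv, le_div_iff₀ (by positivity)]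
    exact_mod_cast hk
  have hS0 : (0 : ℝ) ≤ S := S.2
  refine ContinuousMultilinearMap.opNorm_le_bound (by positivity) fun v => ?_
  rw [hser.iteratedFDeriv_eq_sum_of_completeSpace v]
  calc ‖∑ σ : Equiv.Perm (Fin k), p.changeOrigin y k (fun i => v (σ i))‖
      ≤ ∑ σ : Equiv.Perm (Fin k), ‖p.changeOrigin y k‖ * ∏ i, ‖v i‖ := by
        refine norm_sum_le_of_le _ fun σ _ => ?_
        rw [← Equiv.prod_comp σ (fun i => ‖v i‖)]
        exact (p.changeOrigin y k).le_opNorm _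
    _ = k.factorial * (‖p.changeOrigin y k‖ * ∏ i, ‖v i‖) := by
        simp [Fintype.card_perm]
    _ ≤ k.factorial * ((S * (b : ℝ)⁻¹ ^ k) * ∏ i, ‖v i‖) := by gcongr
    _ = _ := by ring

/-- Uniform Cauchy estimates for an analytic function on a compact set. -/
theorem AnalyticOnNhd.exists_norm_iteratedFDeriv_le {E F : Type*}
    [NormedAddCommGroup E] [NormedSpace ℝ E] [NormedAddCommGroup F] [NormedSpace ℝ F]
    [CompleteSpace F] {f : E → F} {K : Set E} (hf : AnalyticOnNhd ℝ f K) (hK : IsCompact K) :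
    ∃ M R : ℝ, 0 ≤ M ∧ 0 ≤ R ∧
      ∀ z ∈ K, ∀ k : ℕ, ‖iteratedFDeriv ℝ k f z‖ ≤ M * k.factorial * R ^ k := by
  refine hK.induction_on (p := fun s => ∃ M R : ℝ, 0 ≤ M ∧ 0 ≤ R ∧
      ∀ z ∈ s, ∀ k : ℕ, ‖iteratedFDeriv ℝ k f z‖ ≤ M * k.factorial * R ^ k)
    ⟨0, 0, le_rfl, le_rfl, by simp⟩ ?_ ?_ ?_
  · rintro s t hst ⟨M, R, hM, hR, h⟩
    exact ⟨M, R, hM, hR, fun z hz => h z (hst hz)⟩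
  · rintro s t ⟨M, R, hM, hR, h⟩ ⟨M', R', hM', hR', h'⟩
    refine ⟨max M M', max R R', le_max_of_le_left hM, le_max_of_le_left hR, ?_⟩
    rintro z (hz | hz) k
    · refine (h z hz k).trans ?_
      gcongr <;> simp
    · refine (h' z hz k).trans ?_
      gcongr <;> simp
  · intro x hx
    obtain ⟨p, r, hp⟩ := hf x hx
    obtain ⟨M, R, hM, hR, h⟩ := hp.eventually_norm_iteratedFDeriv_le
    exact ⟨_, mem_nhdsWithin_of_mem_nhds h, M, R, hM, hR, fun z hz => hz⟩

theorem norm_iteratedDeriv_prodMk_le {E F : Type*}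
    [NormedAddCommGroup E] [NormedSpace ℝ E] [NormedAddCommGroup F] [NormedSpace ℝ F]
    {f : E × ℝ → F} {k : ℕ} (hf : ContDiff ℝ k f) (p : E) (y : ℝ) :
    ‖iteratedDeriv k (fun t => f (p, t)) y‖ ≤ ‖iteratedFDeriv ℝ k f (p, y)‖ := by
  have hfun : (fun t => f (p, t)) =
      (fun z => f (z + (p, 0))) ∘ ContinuousLinearMap.inr ℝ E ℝ := by
    ext t; simp
  have hc : ContDiff ℝ k (fun z => f (z + (p, 0))) := hf.comp (contDiff_id.add contDiff_const)
  rw [← norm_iteratedFDeriv_eq_norm_iteratedDeriv, hfun,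
    ContinuousLinearMap.iteratedFDeriv_comp_right _ hc _ le_rfl, iteratedFDeriv_comp_add_right]
  refine (ContinuousMultilinearMap.norm_compContinuousLinearMap_le _ _).trans ?_
  simp only [ContinuousLinearMap.inr_apply, Prod.mk_add_mk, zero_add, add_zero]
  refine mul_le_of_le_one_right (norm_nonneg _) (Finset.prod_le_one (fun _ _ => norm_nonneg _) ?_)
  exact fun _ _ => ContinuousLinearMap.norm_inr_le_one ..

/-- A smooth `1`-periodic function deviates from its mean by at most twice the supremum of any
of its iterated derivatives. -/
theorem norm_sub_integral_le_of_norm_iteratedDeriv_le (k : ℕ) {φ : ℝ → ℂ}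
    (hφ : ContDiff ℝ (⊤ : ℕ∞) φ) (hper : Function.Periodic φ 1) {ε : ℝ}
    (h : ∀ t ∈ Icc (0 : ℝ) 1, ‖iteratedDeriv k φ t‖ ≤ ε) :
    ∀ t ∈ Icc (0 : ℝ) 1, ‖φ t - ∫ u in (0 : ℝ)..1, φ u‖ ≤ 2 * ε := by
  induction k generalizing φ with
  | zero =>
    intro t ht
    simp only [iteratedDeriv_zero] at h
    have h1 : ‖∫ u in (0 : ℝ)..1, φ u‖ ≤ ε * |1 - 0| :=
      intervalIntegral.norm_integral_le_of_norm_le_const fun u hu => by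
        rw [uIoc_of_le zero_le_one] at hu
        exact h u (Ioc_subset_Icc_self hu)
    calc _ ≤ ‖φ t‖ + ‖∫ u in (0 : ℝ)..1, φ u‖ := norm_sub_le _ _
      _ ≤ ε + ε * |1 - 0| := add_le_add (h t ht) h1
      _ = 2 * ε := by norm_num; ring
  | succ k ih =>
    intro t ht
    have hd : Differentiable ℝ φ := hφ.differentiable (by simp)
    have hφ' : ContDiff ℝ (⊤ : ℕ∞) (deriv φ) := by
      simpa using hφ.iterate_deriv 1
    have hint : ∫ u in (0 : ℝ)..1, deriv φ u = 0 := by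
      rw [intervalIntegral.integral_deriv_eq_sub (fun x _ => hd x)
        (hφ'.continuous.intervalIntegrable _ _)]
      have := hper 0
      simp only [zero_add] at this
      simp [this]
    have hper' : Function.Periodic (deriv φ) 1 := fun x => by
      rw [← deriv_comp_add_const]
      congr 1
      exact funext hper
    have hbd := ih hφ' hper' (fun t ht => by rw [← iteratedDeriv_succ']; exact h t ht)
    simp only [hint, sub_zero] at hbd
    have hmv : ∀ u ∈ Icc (0 : ℝ) 1, ‖φ t - φ u‖ ≤ 2 * ε := fun u hu => by
      have h2 := (convex_Icc (0 : ℝ) 1).norm_image_sub_le_of_norm_deriv_le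
        (fun x _ => hd x) hbd hu ht
      have hε : 0 ≤ 2 * ε := (norm_nonneg _).trans (hbd t ht)
      refine h2.trans (mul_le_of_le_one_right hε ?_)
      rw [Real.norm_eq_abs, abs_le]
      constructor <;> linarith [ht.1, ht.2, hu.1, hu.2]
    have heq : φ t - ∫ u in (0 : ℝ)..1, φ u = ∫ u in (0 : ℝ)..1, (φ t - φ u) := by
      rw [intervalIntegral.integral_sub (by simp) (hφ.continuous.intervalIntegrable _ _)]
      simp
    rw [heq]
    have h1 : ‖∫ u in (0 : ℝ)..1, (φ t - φ u)‖ ≤ (2 * ε) * |1 - 0| :=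
      intervalIntegral.norm_integral_le_of_norm_le_const fun u hu => by
        rw [uIoc_of_le zero_le_one] at hu
        exact hmv u (Ioc_subset_Icc_self hu)
    simpa using h1

/-- Integrating along the line of slope `n` equals integrating the equally spaced averages. -/
theorem integral_natCast_mul_eq_integral_average {Q : ℝ → ℝ → ℂ}
    (hQ : Continuous (Function.uncurry Q)) (hper : ∀ s y, Q (s + 1) y = Q s y)
    {n : ℕ} (hn : n ≠ 0) :
    ∫ y in (0 : ℝ)..1, Q (n * y) y =
      ∫ t in (0 : ℝ)..1, (n : ℂ)⁻¹ * ∑ j ∈ Finset.range n, Q t ((n : ℝ)⁻¹ * (t + j)) := by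
  have hn' : (n : ℝ) ≠ 0 := Nat.cast_ne_zero.2 hn
  have hg : Continuous fun u : ℝ => Q u ((n : ℝ)⁻¹ * u) :=
    hQ.comp (continuous_id.prodMk (continuous_const.mul continuous_id))
  have hj : ∀ j : ℕ, Continuous fun t : ℝ => Q t ((n : ℝ)⁻¹ * (t + j)) := fun j =>
    hQ.comp (continuous_id.prodMk (continuous_const.mul (continuous_id.add continuous_const)))
  have hshift : ∀ (j : ℕ) (t y : ℝ), Q (t + j) y = Q t y := fun j t y => by
    simpa using Function.Periodic.nat_mul (f := fun s => Q s y) (fun s => hper s y) j t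
  have h1 := intervalIntegral.integral_comp_mul_left (a := 0) (b := 1)
    (fun u : ℝ => Q u ((n : ℝ)⁻¹ * u)) hn'
  simp only [inv_mul_cancel_left₀ hn', mul_zero, mul_one] at h1
  have h2 := intervalIntegral.sum_integral_adjacent_intervals (μ := volume) (n := n)
    (f := fun u : ℝ => Q u ((n : ℝ)⁻¹ * u)) (a := fun j : ℕ => (j : ℝ))
    fun _ _ => hg.intervalIntegrable _ _
  simp only [Nat.cast_zero] at h2
  rw [h1, ← h2, intervalIntegral.integral_const_mul,
    intervalIntegral.integral_finsetSum fun j _ => (hj j).intervalIntegrable _ _,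
    Complex.real_smul]
  push_cast
  congr 1
  refine Finset.sum_congr rfl fun j _ => ?_
  have h3 := intervalIntegral.integral_comp_add_right (a := 0) (b := 1)
    (fun u : ℝ => Q u ((n : ℝ)⁻¹ * u)) (j : ℝ)
  simp only [hshift, zero_add] at h3
  rw [h3, add_comm (1 : ℝ)]

/-- The trapezoidal rule for smooth periodic functions. -/
theorem norm_average_sub_integral_le {h : ℝ → ℂ} (hh : ContDiff ℝ (⊤ : ℕ∞) h)
    (hper : Function.Periodic h 1) {n : ℕ} (hn : n ≠ 0) {k : ℕ} {B : ℝ}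
    (hB : ∀ y ∈ Icc (0 : ℝ) 1, ‖iteratedDeriv k h y‖ ≤ B) {t : ℝ} (ht : t ∈ Icc (0 : ℝ) 1) :
    ‖(n : ℂ)⁻¹ * ∑ j ∈ Finset.range n, h ((n : ℝ)⁻¹ * (t + j)) - ∫ y in (0 : ℝ)..1, h y‖ ≤
      2 * (B / n ^ k) := by
  have hn' : (n : ℝ) ≠ 0 := Nat.cast_ne_zero.2 hn
  have hn0 : (0 : ℝ) < n := by positivity
  have hmean := integral_natCast_mul_eq_integral_average (Q := fun _ y => h y)
    (hh.continuous.comp continuous_snd) (fun _ _ => rfl) hn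
  have hc : ∀ j : ℕ, ContDiff ℝ (⊤ : ℕ∞) fun t : ℝ => h ((n : ℝ)⁻¹ * (t + j)) := fun j =>
    hh.comp (contDiff_const.mul (contDiff_id.add contDiff_const))
  have hderiv : ∀ (j : ℕ) (t : ℝ), iteratedDeriv k (fun t : ℝ => h ((n : ℝ)⁻¹ * (t + j))) t =
      (n : ℝ)⁻¹ ^ k • iteratedDeriv k h ((n : ℝ)⁻¹ * (t + j)) := fun j t => by
    rw [iteratedDeriv_comp_add_const (f := fun t => h ((n : ℝ)⁻¹ * t)),
      iteratedDeriv_comp_const_smul (hh.of_le (by exact_mod_cast le_top))]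
  rw [hmean]
  refine norm_sub_integral_le_of_norm_iteratedDeriv_le k
    (φ := fun t : ℝ => (n : ℂ)⁻¹ * ∑ j ∈ Finset.range n, h ((n : ℝ)⁻¹ * (t + j)))
    (contDiff_const.mul (ContDiff.sum fun j _ => hc j)) ?_ ?_ t ht
  · intro u
    simp only
    congr 1
    have e1 := Finset.sum_range_succ (fun j : ℕ => h ((n : ℝ)⁻¹ * (u + j))) n
    have e2 := Finset.sum_range_succ' (fun j : ℕ => h ((n : ℝ)⁻¹ * (u + j))) n
    have e3 : h ((n : ℝ)⁻¹ * (u + n)) = h ((n : ℝ)⁻¹ * (u + (0 : ℕ))) := by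
      rw [mul_add, inv_mul_cancel₀ hn', hper]; simp
    rw [e1, e3, add_left_inj] at e2
    rw [e2]
    refine Finset.sum_congr rfl fun j _ => ?_
    congr 2
    push_cast
    ring
  · intro u hu
    rw [iteratedDeriv_const_mul_field, iteratedDeriv_fun_sum
      fun j _ => ((hc j).of_le (by exact_mod_cast le_top)).contDiffAt]
    simp only [hderiv]
    rw [norm_mul, norm_inv, Complex.norm_natCast]
    have hterm : ∀ j ∈ Finset.range n,
        ‖(n : ℝ)⁻¹ ^ k • iteratedDeriv k h ((n : ℝ)⁻¹ * (u + j))‖ ≤ B / n ^ k := fun j hj => by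
      have hj' : (j : ℝ) + 1 ≤ n := by exact_mod_cast Finset.mem_range.1 hj
      have hmem : (n : ℝ)⁻¹ * (u + j) ∈ Icc (0 : ℝ) 1 := by
        constructor
        · have := hu.1; positivity
        · rw [inv_mul_le_iff₀ hn0]; linarith [hu.2]
      rw [norm_smul, norm_pow, norm_inv, Real.norm_natCast, inv_pow, inv_mul_eq_div]
      gcongr
      exact hB _ hmem
    calc _ ≤ (n : ℝ)⁻¹ * ∑ _j ∈ Finset.range n, B / n ^ k := by
          gcongr
          exact norm_sum_le_of_le _ hterm
      _ = B / n ^ k := by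
          rw [Finset.sum_const, Finset.card_range, nsmul_eq_mul, inv_mul_cancel_left₀ hn']

theorem norm_integral_natCast_mul_sub_le {Q : ℝ → ℝ → ℂ}
    (hQ : Continuous (Function.uncurry Q)) (hsm : ∀ s, ContDiff ℝ (⊤ : ℕ∞) (Q s))
    (hper : ∀ s y, Q (s + 1) y = Q s y ∧ Q s (y + 1) = Q s y)
    {n : ℕ} (hn : n ≠ 0) {k : ℕ} {B : ℝ}
    (hB : ∀ s ∈ Icc (0 : ℝ) 1, ∀ y ∈ Icc (0 : ℝ) 1, ‖iteratedDeriv k (Q s) y‖ ≤ B) :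
    ‖(∫ y in (0 : ℝ)..1, Q (n * y) y) - ∫ s in (0 : ℝ)..1, ∫ y in (0 : ℝ)..1, Q s y‖ ≤
      2 * (B / n ^ k) := by
  have hj : ∀ j : ℕ, Continuous fun t : ℝ => Q t ((n : ℝ)⁻¹ * (t + j)) := fun j =>
    hQ.comp (continuous_id.prodMk (continuous_const.mul (continuous_id.add continuous_const)))
  have havg : Continuous fun t : ℝ =>
      (n : ℂ)⁻¹ * ∑ j ∈ Finset.range n, Q t ((n : ℝ)⁻¹ * (t + j)) :=
    continuous_const.mul (continuous_finsetSum _ fun j _ => hj j)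
  rw [integral_natCast_mul_eq_integral_average hQ (fun s y => (hper s y).1) hn,
    ← intervalIntegral.integral_sub (havg.intervalIntegrable _ _)
      ((intervalIntegral.continuous_parametric_intervalIntegral_of_continuous' hQ
        0 1).intervalIntegrable _ _)]
  refine (intervalIntegral.norm_integral_le_of_norm_le_const (C := 2 * (B / n ^ k))
    fun t ht => ?_).trans_eq (by simp)
  rw [uIoc_of_le zero_le_one] at ht
  exact norm_average_sub_integral_le (hsm t) (fun y => (hper t y).2) hn
    (hB t (Ioc_subset_Icc_self ht)) (Ioc_subset_Icc_self ht)

theorem norm_integral_intCast_mul_sub_le {Q : ℝ → ℝ → ℂ}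
    (hQ : Continuous (Function.uncurry Q)) (hsm : ∀ s, ContDiff ℝ (⊤ : ℕ∞) (Q s))
    (hper : ∀ s y, Q (s + 1) y = Q s y ∧ Q s (y + 1) = Q s y)
    {n : ℤ} (hn : n ≠ 0) {k : ℕ} {B : ℝ}
    (hB : ∀ s ∈ Icc (-1 : ℝ) 1, ∀ y ∈ Icc (0 : ℝ) 1, ‖iteratedDeriv k (Q s) y‖ ≤ B) :
    ‖(∫ y in (0 : ℝ)..1, Q (n * y) y) - ∫ s in (0 : ℝ)..1, ∫ y in (0 : ℝ)..1, Q s y‖ ≤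
      2 * (B / |(n : ℝ)| ^ k) := by
  obtain ⟨m, rfl | rfl⟩ := n.eq_nat_or_neg
  · have hm : m ≠ 0 := by simpa using hn
    simpa using norm_integral_natCast_mul_sub_le hQ hsm hper hm
      fun s hs => hB s ⟨by linarith [hs.1], hs.2⟩
  · have hm : m ≠ 0 := by simpa using hn
    have hmain := norm_integral_natCast_mul_sub_le (Q := fun s => Q (-s))
      (hQ.comp (continuous_fst.neg.prodMk continuous_snd)) (fun s => hsm (-s))
      (fun s y => ⟨by simpa using ((hper (-(s + 1)) y).1).symm, (hper (-s) y).2⟩) hm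
      fun s hs => hB (-s) ⟨by linarith [hs.2], by linarith [hs.1]⟩
    have hint : ∫ s in (0 : ℝ)..1, ∫ y in (0 : ℝ)..1, Q (-s) y =
        ∫ s in (0 : ℝ)..1, ∫ y in (0 : ℝ)..1, Q s y := by
      rw [intervalIntegral.integral_comp_neg (fun s => ∫ y in (0 : ℝ)..1, Q s y)]
      have hp : Function.Periodic (fun s => ∫ y in (0 : ℝ)..1, Q s y) 1 := fun s => by
        simp only [(hper s _).1]
      simpa using hp.intervalIntegral_add_eq (-1) 0
    rw [hint] at hmain
    simpa using hmain

/-- Optimizing the order `k` in factorial bounds yields exponential decay. -/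
theorem exists_le_exp_of_le_factorial {D : ℤ → ℝ} {M R : ℝ} (hM : 0 ≤ M) (hR : 0 ≤ R)
    (h : ∀ n : ℤ, n ≠ 0 → ∀ k : ℕ, D n ≤ 2 * (M * k.factorial * R ^ k / |(n : ℝ)| ^ k)) :
    ∃ c C : ℝ, 0 < c ∧ 0 < C ∧ ∀ n : ℤ, D n ≤ C * Real.exp (-c * |(n : ℝ)|) := by
  set c : ℝ := Real.exp (-1) / (R + 1) with hc
  have hc0 : 0 < c := by positivity
  refine ⟨c, |D 0| + 2 * M * Real.exp 1 + 1, hc0, by positivity, fun n => ?_⟩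
  rcases eq_or_ne n 0 with rfl | hn
  · have : 0 ≤ 2 * M * Real.exp 1 := by positivity
    simp only [Int.cast_zero, abs_zero, mul_zero, Real.exp_zero, mul_one]
    linarith [le_abs_self (D 0)]
  have hn0 : (0 : ℝ) < |(n : ℝ)| := abs_pos.2 (Int.cast_ne_zero.2 hn)
  set k : ℕ := ⌊c * |(n : ℝ)|⌋₊
  have hk1 : (k : ℝ) ≤ c * |(n : ℝ)| := Nat.floor_le (by positivity)
  have hk2 : c * |(n : ℝ)| < k + 1 := Nat.lt_floor_add_one _
  have hq : k * R / |(n : ℝ)| ≤ Real.exp (-1) := by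
    rw [div_le_iff₀ hn0]
    calc k * R ≤ (c * |(n : ℝ)|) * (R + 1) := by gcongr; linarith
      _ = Real.exp (-1) * |(n : ℝ)| := by rw [hc]; field_simp
  have hfac : (k.factorial : ℝ) ≤ (k : ℝ) ^ k := by exact_mod_cast Nat.factorial_le_pow k
  have hexp : Real.exp (-1) ^ k ≤ Real.exp 1 * Real.exp (-c * |(n : ℝ)|) := by
    rw [← Real.exp_nat_mul, ← Real.exp_add, Real.exp_le_exp]
    linarith
  calc D n ≤ 2 * (M * k.factorial * R ^ k / |(n : ℝ)| ^ k) := h n hn k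
    _ ≤ 2 * (M * (k : ℝ) ^ k * R ^ k / |(n : ℝ)| ^ k) := by gcongr
    _ = 2 * M * (k * R / |(n : ℝ)|) ^ k := by rw [div_pow, mul_pow]; ring
    _ ≤ 2 * M * Real.exp (-1) ^ k := by gcongr
    _ ≤ 2 * M * (Real.exp 1 * Real.exp (-c * |(n : ℝ)|)) := by gcongr
    _ = 2 * M * Real.exp 1 * Real.exp (-c * |(n : ℝ)|) := by ring
    _ ≤ _ := by
      gcongr
      linarith [abs_nonneg (D 0)]

theorem Continuous.intervalIntegral_swap {f : ℝ → ℝ → ℂ} (hf : Continuous (Function.uncurry f))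
    (a b c d : ℝ) :
    ∫ x in a..b, ∫ y in c..d, f x y = ∫ y in c..d, ∫ x in a..b, f x y :=
  intervalIntegral_intervalIntegral_swap <|
    (hf.continuousOn.integrableOn_compact (isCompact_uIcc.prod isCompact_uIcc)).mono_set
      (prod_mono uIoc_subset_uIcc uIoc_subset_uIcc)

theorem Continuous.setIntegral_unitSquare_eq {f : ℝ × ℝ → ℂ} (hf : Continuous f) :
    ∫ q in Icc (0 : ℝ) 1 ×ˢ Icc (0 : ℝ) 1, f q =
      ∫ x in (0 : ℝ)..1, ∫ y in (0 : ℝ)..1, f (x, y) := by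
  rw [Measure.volume_eq_prod, setIntegral_prod _
    (hf.continuousOn.integrableOn_compact (isCompact_Icc.prod isCompact_Icc))]
  simp only [intervalIntegral.integral_of_le zero_le_one, integral_Icc_eq_integral_Ioc]

/-- The integral of a product of fibre means, as an integral of fibrewise cross-correlations. -/
theorem integral_mul_integral_eq_integral_correlation {A F : ℝ × ℝ → ℂ} (hA : Continuous A)
    (hF : Continuous F) (hper : ∀ x y : ℝ, F (x + 1, y) = F (x, y)) :
    ∫ y in (0 : ℝ)..1, (∫ x in (0 : ℝ)..1, A (x, y)) * (∫ x in (0 : ℝ)..1, F (x, y)) =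
      ∫ x in (0 : ℝ)..1, ∫ s in (0 : ℝ)..1, ∫ y in (0 : ℝ)..1, A (x, y) * F (x + s, y) := by
  have hshift : ∀ x y : ℝ, ∫ s in (0 : ℝ)..1, F (x + s, y) = ∫ s in (0 : ℝ)..1, F (s, y) := by
    intro x y
    rw [intervalIntegral.integral_comp_add_left (fun s => F (s, y))]
    simpa using Function.Periodic.intervalIntegral_add_eq
      (f := fun s => F (s, y)) (fun s => hper s y) x 0
  have hswap : ∀ x : ℝ, ∫ s in (0 : ℝ)..1, ∫ y in (0 : ℝ)..1, A (x, y) * F (x + s, y) =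
      ∫ y in (0 : ℝ)..1, A (x, y) * ∫ s in (0 : ℝ)..1, F (s, y) := by
    intro x
    rw [Continuous.intervalIntegral_swap (by unfold Function.uncurry; fun_prop)]
    simp only [intervalIntegral.integral_const_mul, hshift]
  have hFm : Continuous fun y : ℝ => ∫ s in (0 : ℝ)..1, F (s, y) :=
    intervalIntegral.continuous_parametric_intervalIntegral_of_continuous'
      (by unfold Function.uncurry; fun_prop) 0 1
  simp only [hswap]
  rw [Continuous.intervalIntegral_swap (by unfold Function.uncurry; fun_prop)]
  simp only [intervalIntegral.integral_mul_const]

/-- Exponential decay of conditional correlations of the parabolic map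
`T(x,y) = (x + y, y)` of `𝕋²` for real-analytic observables: the observables are given by
real-analytic `ℤ²`-periodic lifts `F₁, F₂ : ℝ² → ℂ`; `Tⁿ` lifts to `(x, y) ↦ (x + n y, y)`,
and integrals over `𝕋²` become integrals over the unit square. -/
theorem stmt10 (F₁ F₂ : ℝ × ℝ → ℂ)
    (hF₁ : AnalyticOnNhd ℝ F₁ Set.univ) (hF₂ : AnalyticOnNhd ℝ F₂ Set.univ)
    (hper₁ : ∀ x y : ℝ, F₁ (x + 1, y) = F₁ (x, y) ∧ F₁ (x, y + 1) = F₁ (x, y))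
    (hper₂ : ∀ x y : ℝ, F₂ (x + 1, y) = F₂ (x, y) ∧ F₂ (x, y + 1) = F₂ (x, y)) :
    ∃ c C : ℝ, 0 < c ∧ 0 < C ∧ ∀ n : ℤ,
      ‖(∫ q in Set.Icc (0 : ℝ) 1 ×ˢ Set.Icc (0 : ℝ) 1,
            (starRingEnd ℂ) (F₁ q) * F₂ (q.1 + (n : ℝ) * q.2, q.2))
        - ∫ y in Set.Icc (0 : ℝ) 1,
            (∫ x in Set.Icc (0 : ℝ) 1, (starRingEnd ℂ) (F₁ (x, y)))
              * (∫ x in Set.Icc (0 : ℝ) 1, F₂ (x, y))‖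
      ≤ C * Real.exp (-c * |(n : ℝ)|) := by
  
  set P : (ℝ × ℝ) × ℝ → ℂ := fun z =>
    (starRingEnd ℂ) (F₁ (z.1.1, z.2)) * F₂ (z.1.1 + z.1.2, z.2) with hP
  have hA₁ : AnalyticOnNhd ℝ (fun q => (starRingEnd ℂ) (F₁ q)) univ := fun q _ =>
    (Complex.conjCLE.toContinuousLinearMap.analyticAt _).comp (hF₁ q trivial)
  have hPa : AnalyticOnNhd ℝ P univ := fun z _ => by
    refine AnalyticAt.mul ?_ ?_
    · exact (hA₁ (z.1.1, z.2) trivial).comp_of_eq (f := fun z : (ℝ × ℝ) × ℝ => (z.1.1, z.2))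
        (ContDiffAt.analyticAt (by fun_prop)) rfl
    · exact (hF₂ (z.1.1 + z.1.2, z.2) trivial).comp_of_eq
        (f := fun z : (ℝ × ℝ) × ℝ => (z.1.1 + z.1.2, z.2)) (ContDiffAt.analyticAt (by fun_prop)) rfl
  have hPd : ContDiff ℝ (⊤ : ℕ∞) P := contDiffOn_univ.1 hPa.contDiffOn_of_completeSpace
  have hPc : Continuous P := hPd.continuous
  have hA₁c : Continuous fun q => (starRingEnd ℂ) (F₁ q) := continuousOn_univ.1 hA₁.continuousOn
  have hF₂c : Continuous F₂ := continuousOn_univ.1 hF₂.continuousOn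
  obtain ⟨M, R, hM, hR, hbd⟩ := (hPa.mono (subset_univ _)).exists_norm_iteratedFDeriv_le
    ((isCompact_Icc (a := (0 : ℝ)) (b := 1)).prod (isCompact_Icc (a := (-1 : ℝ)) (b := 1)) |>.prod
      (isCompact_Icc (a := (0 : ℝ)) (b := 1)))
  refine exists_le_exp_of_le_factorial hM hR fun n hn k => ?_
  have hmean := integral_mul_integral_eq_integral_correlation hA₁c hF₂c fun x y => (hper₂ x y).1
  rw [Continuous.setIntegral_unitSquare_eq (by fun_prop)]
  simp only [integral_Icc_eq_integral_Ioc, ← intervalIntegral.integral_of_le (zero_le_one' ℝ)]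
  rw [hmean, ← intervalIntegral.integral_sub]
  · refine (intervalIntegral.norm_integral_le_of_norm_le_const
      (C := 2 * (M * k.factorial * R ^ k / |(n : ℝ)| ^ k)) fun x hx => ?_).trans_eq (by simp)
    rw [uIoc_of_le zero_le_one] at hx
    refine norm_integral_intCast_mul_sub_le (Q := fun s y => P ((x, s), y))
      (by unfold Function.uncurry; fun_prop) (fun s => by fun_prop) (fun s y => ?_) hn
      fun s hs y hy => ?_
    · simp only [hP]
      constructor
      · rw [← add_assoc, (hper₂ _ _).1]
      · rw [(hper₁ _ _).2, (hper₂ _ _).2]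
    · exact (norm_iteratedDeriv_prodMk_le (hPd.of_le (by exact_mod_cast le_top)) _ _).trans
        (hbd _ ⟨⟨Ioc_subset_Icc_self hx, hs⟩, hy⟩ k)
  · refine Continuous.intervalIntegrable ?_ _ _
    exact intervalIntegral.continuous_parametric_intervalIntegral_of_continuous'
      (by unfold Function.uncurry; fun_prop) 0 1
  · refine Continuous.intervalIntegrable ?_ _ _
    refine intervalIntegral.continuous_parametric_intervalIntegral_of_continuous' ?_ 0 1
    exact intervalIntegral.continuous_parametric_intervalIntegral_of_continuous'
      (f := fun (q : ℝ × ℝ) y => P (q, y)) hPc 0 1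
end

section
/- Let σ_{x,r} be the uniform probability measure on the sphere S(x,r) ⊂ ℝ^n of center x and radius r, n ≥ 2, and let ε ∈ (0, 1/2). Then lim_{r→+∞} σ_{x,r}({y ∈ ℝ^n : dist(y, ℤ^n) ≤ ε}) = ε^n · vol(B_{ℝ^n}(0,1)), where vol(B_{ℝ^n}(0,1)) is the Lebesgue volume of the unit ball. -/
open MeasureTheory Filter Set
open scoped ENNReal Topology

/-- The uniform probability measure on the sphere `S(x, r) ⊆ ℝⁿ`: the pushforward under
`v ↦ x + r v` of the normalized surface measure on the unit sphere. -/
noncomputable def sphereUniform (n : ℕ) (x : EuclideanSpace ℝ (Fin n)) (r : ℝ) :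
    Measure (EuclideanSpace ℝ (Fin n)) :=
  Measure.map (fun v : Metric.sphere (0 : EuclideanSpace ℝ (Fin n)) 1 =>
      x + r • (v : EuclideanSpace ℝ (Fin n)))
    ((((volume : Measure (EuclideanSpace ℝ (Fin n))).toSphere) Set.univ)⁻¹ •
      ((volume : Measure (EuclideanSpace ℝ (Fin n))).toSphere))

open Real FourierTransform in
theorem tendsto_integral_fourierChar_of_absolutelyContinuous (ρ : Measure ℝ) [IsFiniteMeasure ρ]
    (hρ : ρ ≪ volume) :
    Tendsto (fun w : ℝ => ∫ t, (𝐞 (t * w) : ℂ) ∂ρ) atTop (𝓝 0) := by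
  have h := Real.tendsto_integral_exp_smul_cocompact
    (fun t => (((ρ.rnDeriv volume t).toReal : ℝ) : ℂ))
  have h' : Tendsto (fun w : ℝ => -w) atTop (cocompact ℝ) :=
    (tendsto_neg_atTop_atBot).mono_right atBot_le_cocompact
  refine (h.comp h').congr fun w => ?_
  rw [← integral_rnDeriv_smul hρ]
  refine integral_congr_ae (.of_forall fun t => ?_)
  simp [Circle.smul_def, mul_comm]

theorem volume_preimage_eq_zero_of_hasDerivAt_pos {f f' : ℝ → ℝ}
    (hf : ∀ t, HasDerivAt f (f' t) t) (hf' : ∀ t, 0 < f' t) {N : Set ℝ} (hN : MeasurableSet N)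
    (hN0 : volume N = 0) : volume (f ⁻¹' N) = 0 := by
  have hmono : StrictMono f := strictMono_of_deriv_pos fun t => by
    rw [(hf t).deriv]; exact hf' t
  have hcont : Continuous f := continuous_iff_continuousAt.2 fun t => (hf t).continuousAt
  have hmeas : MeasurableSet (f ⁻¹' N) := hcont.measurable hN
  have h := lintegral_image_eq_lintegral_abs_deriv_mul hmeas
    (fun t _ => (hf t).hasDerivWithinAt) hmono.injective.injOn (fun _ => 1)
  have h0 : volume (f '' (f ⁻¹' N)) = 0 := measure_mono_null (image_preimage_subset f N) hN0
  simp only [mul_one, lintegral_const, Measure.restrict_apply_univ, one_mul, h0] at h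
  have hderiv : f' = deriv f := funext fun t => (hf t).deriv.symm
  have hm : Measurable fun t => ENNReal.ofReal |f' t| := by
    rw [hderiv]; exact ((measurable_deriv f).abs).ennreal_ofReal
  have hae := (setLIntegral_eq_zero_iff hmeas hm).1 h.symm
  refine measure_mono_null (fun t ht => ?_) hae
  simp only [mem_compl_iff]
  exact fun hh => (by simpa using hh ht : f' t = 0) |> (hf' t).ne'

section InnerProduct

variable {E : Type*} [NormedAddCommGroup E] [InnerProductSpace ℝ E]

theorem hasDerivAt_inner_div_norm {y ξ : E} {t : ℝ} (h : y + t • ξ ≠ 0) :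
    HasDerivAt (fun s : ℝ => inner ℝ (y + s • ξ) ξ / ‖y + s • ξ‖)
      ((‖ξ‖ ^ 2 * ‖y + t • ξ‖ ^ 2 - inner ℝ (y + t • ξ) ξ ^ 2) / ‖y + t • ξ‖ ^ 3) t := by
  have hw : HasDerivAt (fun s : ℝ => y + s • ξ) ξ t := by
    simpa using ((hasDerivAt_id t).smul_const ξ).const_add y
  have hpos : 0 < ‖y + t • ξ‖ := norm_pos_iff.2 h
  have hnum : HasDerivAt (fun s : ℝ => inner ℝ (y + s • ξ) ξ) (‖ξ‖ ^ 2) t := by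
    simpa using hw.inner ℝ (hasDerivAt_const t ξ)
  have hden : HasDerivAt (fun s : ℝ => ‖y + s • ξ‖) (inner ℝ (y + t • ξ) ξ / ‖y + t • ξ‖) t := by
    have := hw.norm_sq.sqrt (by positivity)
    simp only [Real.sqrt_sq (norm_nonneg _)] at this
    convert! this using 1
    field_simp
  convert! hnum.div hden hpos.ne' using 1
  field_simp

theorem inner_sq_lt_of_notMem_span {y ξ : E} (hξ : ξ ≠ 0) (hy : y ∉ Submodule.span ℝ {ξ}) :
    inner ℝ y ξ ^ 2 < ‖ξ‖ ^ 2 * ‖y‖ ^ 2 := by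
  have hle := abs_real_inner_le_norm y ξ
  have hne : |inner ℝ y ξ| ≠ ‖y‖ * ‖ξ‖ := by
    intro h
    apply hy
    by_cases hy0 : y = 0
    · simp [hy0]
    have h2 : ‖inner ℝ ξ y‖ = ‖ξ‖ * ‖y‖ := by
      rw [real_inner_comm, mul_comm]; exact h
    obtain ⟨r, -, hr⟩ := (norm_inner_eq_norm_iff hξ hy0).1 h2
    exact Submodule.mem_span_singleton.2 ⟨r, hr.symm⟩
  have hlt := lt_of_le_of_ne hle hne
  rw [← sq_abs, ← mul_pow, mul_comm ‖ξ‖]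
  gcongr

variable [FiniteDimensional ℝ E] [MeasurableSpace E] [BorelSpace E]

theorem volume_inner_div_norm_mem_eq_zero (hE : 2 ≤ Module.finrank ℝ E) {ξ : E} (hξ : ξ ≠ 0)
    {N : Set ℝ} (hN : MeasurableSet N) (hN0 : volume N = 0) :
    volume {y : E | inner ℝ y ξ / ‖y‖ ∈ N} = 0 := by
  have hmeas : MeasurableSet {y : E | inner ℝ y ξ / ‖y‖ ∉ N} := by
    have : Measurable fun y : E => inner ℝ y ξ / ‖y‖ := by fun_prop
    exact this hN.compl
  have hspan : ∀ᵐ y : E, y ∉ Submodule.span ℝ {ξ} := by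
    refine measure_eq_zero_iff_ae_notMem.1 (Measure.addHaar_submodule volume _ fun h => ?_)
    have h1 := finrank_span_singleton (K := ℝ) hξ
    rw [h, finrank_top] at h1
    omega
  have key : ∀ᵐ y : E, y ∈ {y : E | inner ℝ y ξ / ‖y‖ ∉ N} := by
    rw [← ae_ae_add_linearMap_mem_iff (LinearMap.toSpanSingleton ℝ E ξ) volume volume hmeas]
    filter_upwards [hspan] with y hy
    have hy' : ∀ t : ℝ, y + t • ξ ∉ Submodule.span ℝ {ξ} := fun t ht =>
      hy ((Submodule.add_mem_iff_left _
        (Submodule.smul_mem _ t (Submodule.mem_span_singleton_self ξ))).1 ht)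
    have hne : ∀ t : ℝ, y + t • ξ ≠ 0 := fun t h => hy' t (h ▸ Submodule.zero_mem _)
    have := volume_preimage_eq_zero_of_hasDerivAt_pos
      (fun t => hasDerivAt_inner_div_norm (hne t))
      (fun t => div_pos (sub_pos.2 (inner_sq_lt_of_notMem_span hξ (hy' t)))
        (pow_pos (norm_pos_iff.2 (hne t)) 3)) hN hN0
    exact measure_eq_zero_iff_ae_notMem.1 this
  exact measure_eq_zero_iff_ae_notMem.2 key

theorem map_inner_toSphere_absolutelyContinuous (hE : 2 ≤ Module.finrank ℝ E) {ξ : E}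
    (hξ : ξ ≠ 0) :
    (volume : Measure E).toSphere.map (fun v : Metric.sphere (0 : E) 1 => inner ℝ (v : E) ξ) ≪ volume := by
  refine Measure.AbsolutelyContinuous.mk fun N hN hN0 => ?_
  have hm : Measurable fun v : Metric.sphere (0 : E) 1 => inner ℝ (v : E) ξ := by fun_prop
  rw [Measure.map_apply hm hN, Measure.toSphere_apply' _ (hm hN)]
  refine mul_eq_zero_of_right _ (measure_mono_null ?_
    (volume_inner_div_norm_mem_eq_zero hE hξ hN hN0))
  rintro _ ⟨s, hs, _, ⟨v, hv, rfl⟩, rfl⟩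
  have hv1 : ‖(v : E)‖ = 1 := norm_eq_of_mem_sphere v
  simpa [inner_smul_left, norm_smul, hv1, abs_of_pos hs.1, hs.1.ne'] using hv

open Real FourierTransform in
theorem tendsto_integral_fourierChar_inner_toSphere (hE : 2 ≤ Module.finrank ℝ E) {ξ : E}
    (hξ : ξ ≠ 0) :
    Tendsto (fun r : ℝ => ∫ v, (𝐞 (r * inner ℝ (v : E) ξ) : ℂ) ∂(volume : Measure E).toSphere)
      atTop (𝓝 0) := by
  refine (tendsto_integral_fourierChar_of_absolutelyContinuous _
    (map_inner_toSphere_absolutelyContinuous hE hξ)).congr fun r => ?_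
  rw [integral_map (by fun_prop) (by fun_prop)]
  simp only [mul_comm]

end InnerProduct

section Weyl

theorem integral_mFourier_eq_zero {d : Type*} [Fintype d] {k : d → ℤ} (hk : k ≠ 0) :
    ∫ p : UnitAddTorus d, UnitAddTorus.mFourier k p = 0 := by
  obtain ⟨i, hi⟩ := Function.ne_iff.mp hk
  simp only [UnitAddTorus.mFourier, ContinuousMap.coe_mk]
  rw [integral_fintype_prod_volume_eq_prod (fun i (t : UnitAddCircle) => fourier (k i) t)]
  exact Finset.prod_eq_zero (Finset.mem_univ i)
    (integral_eq_zero_of_add_right_eq_neg (fourier_add_half_inv_index hi one_pos))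

/-- Convergence of integrals against a dense family of continuous functions implies weak
convergence on a compact space. -/
theorem ProbabilityMeasure.tendsto_of_span_dense {X ι κ : Type*} [TopologicalSpace X]
    [CompactSpace X] [MeasurableSpace X] [OpensMeasurableSpace X] {l : Filter ι}
    {μs : ι → ProbabilityMeasure X} {μ : ProbabilityMeasure X} (e : κ → C(X, ℂ))
    (he : (Submodule.span ℂ (range e)).topologicalClosure = ⊤)
    (h : ∀ k, Tendsto (fun i => ∫ x, e k x ∂(μs i : Measure X)) l
      (𝓝 (∫ x, e k x ∂(μ : Measure X)))) :
    Tendsto μs l (𝓝 μ) := by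
  have hint : ∀ (ν : ProbabilityMeasure X) (g : C(X, ℂ)), Integrable g (ν : Measure X) :=
    fun ν g => (BoundedContinuousFunction.mkOfCompact g).integrable _
  have hspan : ∀ g ∈ Submodule.span ℂ (range e),
      Tendsto (fun i => ∫ x, g x ∂(μs i : Measure X)) l (𝓝 (∫ x, g x ∂(μ : Measure X))) := by
    intro g hg
    induction hg using Submodule.span_induction with
    | mem g hg => obtain ⟨k, rfl⟩ := hg; exact h k
    | zero => simpa using tendsto_const_nhds
    | add f g _ _ hf hg =>
      simp only [ContinuousMap.add_apply, integral_add (hint _ f) (hint _ g)]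
      exact hf.add hg
    | smul c f _ hf =>
      simp only [ContinuousMap.smul_apply, integral_smul]
      exact hf.const_smul c
  rw [ProbabilityMeasure.tendsto_iff_forall_integral_rclike_tendsto ℂ]
  intro f
  rw [Metric.tendsto_nhds]
  intro δ hδ
  have hf : f.toContinuousMap ∈ closure (Submodule.span ℂ (range e) : Set C(X, ℂ)) := by
    rw [← Submodule.topologicalClosure_coe, he]; trivial
  obtain ⟨g, hg, hfg⟩ := Metric.mem_closure_iff.1 hf (δ / 3) (by positivity)
  have hdist : ∀ ν : ProbabilityMeasure X,
      dist (∫ x, f x ∂(ν : Measure X)) (∫ x, g x ∂(ν : Measure X)) ≤ δ / 3 := by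
    intro ν
    rw [dist_eq_norm, ← integral_sub (f.integrable _) (hint ν g)]
    refine (norm_integral_le_of_norm_le_const (C := δ / 3) (.of_forall fun x => ?_)).trans
      (by simp)
    rw [← dist_eq_norm]
    exact (ContinuousMap.dist_apply_le_dist (f := f.toContinuousMap) (g := g) x).trans hfg.le
  filter_upwards [Metric.tendsto_nhds.1 (hspan g hg) (δ / 3) (by positivity)] with i hi
  have h1 := hdist (μs i)
  have h2 := hdist μ
  rw [dist_comm] at h2
  calc _ ≤ _ := dist_triangle4 _ (∫ x, g x ∂(μs i : Measure X)) (∫ x, g x ∂(μ : Measure X)) _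
    _ < δ := by linarith

end Weyl

section Torus

instance : IsProbabilityMeasure (volume : Measure UnitAddCircle) := ⟨UnitAddCircle.measure_univ⟩

instance {d : Type*} [Fintype d] : IsProbabilityMeasure (volume : Measure (UnitAddTorus d)) :=
  inferInstanceAs (IsProbabilityMeasure (Measure.pi fun _ => volume))

variable {n : ℕ}

/-- The covering map `ℝⁿ → 𝕋ⁿ`. -/
def torusMk (y : EuclideanSpace ℝ (Fin n)) : UnitAddTorus (Fin n) := fun i => (y i : UnitAddCircle)

theorem continuous_torusMk : Continuous (torusMk (n := n)) :=
  continuous_pi fun i => (AddCircle.continuous_mk' 1).comp (by fun_prop)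

theorem isOpenMap_torusMk : IsOpenMap (torusMk (n := n)) :=
  (IsOpenMap.piMap (fun _ : Fin n => QuotientAddGroup.isOpenMap_coe)
    (by simp)).comp (PiLp.homeomorph 2 (fun _ : Fin n => ℝ)).isOpenMap

theorem torusMk_eq_iff {y z : EuclideanSpace ℝ (Fin n)} :
    torusMk y = torusMk z ↔ ∀ i, ∃ m : ℤ, (y - z) i = (m : ℝ) := by
  simp only [torusMk, funext_iff, PiLp.sub_apply]
  refine forall_congr' fun i => ?_
  rw [← sub_eq_zero, ← AddCircle.coe_sub, AddCircle.coe_eq_zero_iff]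
  simp [eq_comm]

open Real FourierTransform in
theorem mFourier_torusMk (k : Fin n → ℤ) (y : EuclideanSpace ℝ (Fin n)) :
    UnitAddTorus.mFourier k (torusMk y) =
      (𝐞 (inner ℝ y (WithLp.toLp 2 fun i => (k i : ℝ))) : ℂ) := by
  simp only [UnitAddTorus.mFourier, ContinuousMap.coe_mk, torusMk, fourier_coe_apply,
    Real.fourierChar_apply, ← Complex.exp_sum, PiLp.inner_apply]
  congr 1
  simp only [RCLike.inner_apply, conj_trivial, Complex.ofReal_sum, Finset.mul_sum, Finset.sum_mul]
  refine Finset.sum_congr rfl fun i _ => ?_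
  push_cast
  ring

theorem measurePreserving_torusMk (a : ℝ) :
    MeasurePreserving (torusMk (n := n))
      (volume.restrict {y : EuclideanSpace ℝ (Fin n) | ∀ i, y i ∈ Ioc a (a + 1)}) volume := by
  have h1 : MeasurePreserving (fun (y : Fin n → ℝ) i => (y i : UnitAddCircle))
      (volume.restrict (univ.pi fun _ => Ioc a (a + 1))) volume := by
    rw [volume_pi, Measure.restrict_pi_pi, volume_pi]
    exact measurePreserving_pi _ _ fun _ => UnitAddCircle.measurePreserving_mk a
  have h2 := (PiLp.volume_preserving_ofLp (Fin n)).restrict_preimage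
    (MeasurableSet.univ_pi fun _ : Fin n => measurableSet_Ioc (a := a) (b := a + 1))
  have h3 := h1.comp h2
  convert! h3 using 2
  ext y
  simp

theorem volume_torusMk_image {s : Set (EuclideanSpace ℝ (Fin n))} (hs : IsCompact s) {a : ℝ}
    (hsa : ∀ y ∈ s, ∀ i, y i ∈ Ioc a (a + 1)) : volume (torusMk '' s) = volume s := by
  rw [← (measurePreserving_torusMk a).measure_preimage
    (hs.image continuous_torusMk).measurableSet.nullMeasurableSet,
    Measure.restrict_apply (continuous_torusMk.measurable (hs.image continuous_torusMk).measurableSet)]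
  congr 1
  ext y
  constructor
  · rintro ⟨⟨z, hz, hzy⟩, hy⟩
    suffices z = y from this ▸ hz
    ext i
    obtain ⟨m, hm⟩ := torusMk_eq_iff.1 hzy i
    have h1 := hsa z hz i
    have h2 := hy i
    simp only [PiLp.sub_apply] at hm
    simp only [mem_Ioc] at h1 h2
    have h3 : (m : ℝ) < 1 := by linarith
    have h4 : (-1 : ℝ) < m := by linarith
    have h5 : m = 0 := by
      have : m < 1 := by exact_mod_cast h3
      have : -1 < m := by exact_mod_cast h4
      omega
    rw [h5] at hm
    push_cast at hm
    linarith
  · exact fun hy => ⟨mem_image_of_mem _ hy, hsa y hy⟩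

theorem isClosed_integerLattice :
    IsClosed {z : EuclideanSpace ℝ (Fin n) | ∀ i, ∃ m : ℤ, z i = (m : ℝ)} := by
  have : {z : EuclideanSpace ℝ (Fin n) | ∀ i, ∃ m : ℤ, z i = (m : ℝ)} =
      ⋂ i, (fun z : EuclideanSpace ℝ (Fin n) => z i) ⁻¹' range ((↑) : ℤ → ℝ) := by
    ext z
    simp [eq_comm]
  rw [this]
  exact isClosed_iInter fun i => Int.isClosedEmbedding_coe_real.isClosed_range.preimage
    (by fun_prop)

theorem torusMk_preimage_image_closedBall (ε : ℝ) :
    torusMk ⁻¹' (torusMk '' Metric.closedBall 0 ε) = {y : EuclideanSpace ℝ (Fin n) |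
      Metric.infDist y {z : EuclideanSpace ℝ (Fin n) | ∀ i, ∃ m : ℤ, z i = (m : ℝ)} ≤ ε} := by
  ext y
  constructor
  · rintro ⟨z, hz, hzy⟩
    have hmem : y - z ∈ {z : EuclideanSpace ℝ (Fin n) | ∀ i, ∃ m : ℤ, z i = (m : ℝ)} :=
      torusMk_eq_iff.1 hzy.symm
    refine (Metric.infDist_le_dist_of_mem hmem).trans ?_
    simpa [dist_eq_norm] using hz
  · intro hy
    obtain ⟨z, hz, hyz⟩ := isClosed_integerLattice.exists_infDist_eq_dist ⟨0, fun i => ⟨0, by simp⟩⟩ y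
    refine ⟨y - z, ?_, ?_⟩
    · rw [mem_closedBall_zero_iff, ← dist_eq_norm, ← hyz]
      exact hy
    · refine (torusMk_eq_iff.2 ?_).symm
      simpa using hz

theorem volume_frontier_torusMk_image_closedBall {ε : ℝ} (hε0 : 0 < ε) (hε : ε < 1 / 2) :
    volume (frontier (torusMk '' Metric.closedBall (0 : EuclideanSpace ℝ (Fin n)) ε)) = 0 := by
  have hsub : frontier (torusMk '' Metric.closedBall (0 : EuclideanSpace ℝ (Fin n)) ε) ⊆
      torusMk '' Metric.sphere 0 ε := by
    rw [((isCompact_closedBall _ _).image continuous_torusMk).isClosed.frontier_eq]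
    have hint := (isOpenMap_torusMk _ Metric.isOpen_ball).subset_interior_iff.2
      (image_mono (Metric.ball_subset_closedBall (x := (0 : EuclideanSpace ℝ (Fin n))) (ε := ε)))
    rintro _ ⟨⟨y, hy, rfl⟩, hy'⟩
    refine ⟨y, ?_, rfl⟩
    by_contra hne
    exact hy' (hint ⟨y, lt_of_le_of_ne hy hne, rfl⟩)
  refine measure_mono_null hsub ?_
  rw [volume_torusMk_image (isCompact_sphere _ _) (a := -1 / 2)]
  · exact Measure.addHaar_sphere_of_ne_zero _ _ hε0.ne'
  · intro y hy i
    have := (PiLp.norm_apply_le y i).trans (mem_sphere_zero_iff_norm.1 hy).le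
    rw [Real.norm_eq_abs, abs_le] at this
    constructor <;> linarith

theorem volume_torusMk_image_closedBall {ε : ℝ} (hε0 : 0 ≤ ε) (hε : ε < 1 / 2) :
    volume (torusMk '' Metric.closedBall (0 : EuclideanSpace ℝ (Fin n)) ε) =
      ENNReal.ofReal (ε ^ n) * volume (Metric.ball (0 : EuclideanSpace ℝ (Fin n)) 1) := by
  rw [volume_torusMk_image (isCompact_closedBall _ _) (a := -1 / 2)]
  · simpa using Measure.addHaar_closedBall volume (0 : EuclideanSpace ℝ (Fin n)) hε0
  · intro y hy i
    have := (PiLp.norm_apply_le y i).trans (mem_closedBall_zero_iff.1 hy)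
    rw [Real.norm_eq_abs, abs_le] at this
    constructor <;> linarith

end Torus

section Equidistribution

variable {n : ℕ}

theorem isProbabilityMeasure_sphereUniform (hn : 2 ≤ n) (x : EuclideanSpace ℝ (Fin n)) (r : ℝ) :
    IsProbabilityMeasure (sphereUniform n x r) := by
  have : NeZero n := ⟨by omega⟩
  have : NeZero (volume : Measure (EuclideanSpace ℝ (Fin n))).toSphere :=
    ⟨Measure.toSphere_ne_zero _⟩
  exact Measure.isProbabilityMeasure_map (by fun_prop)

theorem isProbabilityMeasure_map_torusMk (hn : 2 ≤ n) (x : EuclideanSpace ℝ (Fin n)) (r : ℝ) :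
    IsProbabilityMeasure ((sphereUniform n x r).map torusMk) :=
  have := isProbabilityMeasure_sphereUniform hn x r
  Measure.isProbabilityMeasure_map continuous_torusMk.aemeasurable

theorem tendsto_integral_mFourier_sphereUniform (hn : 2 ≤ n) (x : EuclideanSpace ℝ (Fin n))
    {k : Fin n → ℤ} (hk : k ≠ 0) :
    Tendsto (fun r => ∫ p, UnitAddTorus.mFourier k p ∂((sphereUniform n x r).map torusMk))
      atTop (𝓝 0) := by
  set ξ : EuclideanSpace ℝ (Fin n) := WithLp.toLp 2 fun i => (k i : ℝ) with hξdef
  have hξ : ξ ≠ 0 := by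
    obtain ⟨i, hi⟩ := Function.ne_iff.mp hk
    intro h
    exact hi (by simpa [hξdef] using congrArg (fun z : EuclideanSpace ℝ (Fin n) => z i) h)
  have h := tendsto_integral_fourierChar_inner_toSphere (by simpa using hn) hξ
  have h' := (h.const_mul ((Real.fourierChar (inner ℝ x ξ) : Circle) : ℂ)).const_smul
    (((volume : Measure (EuclideanSpace ℝ (Fin n))).toSphere univ)⁻¹).toReal
  simp only [mul_zero, smul_zero] at h'
  refine h'.congr fun r => ?_
  have hc : Continuous (UnitAddTorus.mFourier k) := (UnitAddTorus.mFourier k).continuous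
  rw [integral_map continuous_torusMk.aemeasurable hc.aestronglyMeasurable, sphereUniform,
    integral_map (f := fun y => UnitAddTorus.mFourier k (torusMk y)) (by fun_prop)
      (hc.comp continuous_torusMk).aestronglyMeasurable,
    integral_smul_measure, ← integral_const_mul]
  congr 2 with v
  rw [mFourier_torusMk, inner_add_left, inner_smul_left, AddChar.map_add_eq_mul]
  simp [hξdef]

/-- The projections to the torus of spheres of radius `r` equidistribute as `r → ∞`. -/
theorem tendsto_map_torusMk_sphereUniform (hn : 2 ≤ n) (x : EuclideanSpace ℝ (Fin n)) :
    Tendsto (β := ProbabilityMeasure (UnitAddTorus (Fin n)))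
      (fun r => ⟨(sphereUniform n x r).map torusMk, isProbabilityMeasure_map_torusMk hn x r⟩)
      atTop (𝓝 ⟨volume, inferInstance⟩) := by
  refine ProbabilityMeasure.tendsto_of_span_dense UnitAddTorus.mFourier
    UnitAddTorus.span_mFourier_closure_eq_top fun k => ?_
  by_cases hk : k = 0
  · have hone : ∀ ν : ProbabilityMeasure (UnitAddTorus (Fin n)),
        ∫ p, UnitAddTorus.mFourier k p ∂(ν : Measure (UnitAddTorus (Fin n))) = 1 := fun ν => by
      simp [hk, UnitAddTorus.mFourier_zero]
    exact (tendsto_const_nhds.congr fun r => (hone ⟨_, _⟩).symm).trans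
      (congrArg 𝓝 (hone ⟨volume, inferInstance⟩).symm).le
  · simpa only [ProbabilityMeasure.coe_mk, integral_mFourier_eq_zero hk] using
      tendsto_integral_mFourier_sphereUniform hn x hk

end Equidistribution

/-- For `n ≥ 2`, `ε ∈ (0, 1/2)` and any center `x`, the uniform measure of the
`ε`-neighborhood of the lattice `ℤⁿ` seen from the sphere `S(x,r)` converges, as `r → ∞`,
to `εⁿ · vol(B(0,1))`. -/
theorem stmt12 (n : ℕ) (hn : 2 ≤ n) (ε : ℝ) (hε : ε ∈ Set.Ioo (0 : ℝ) (1 / 2))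
    (x : EuclideanSpace ℝ (Fin n)) :
    Tendsto (fun r : ℝ =>
        (sphereUniform n x r
          {y : EuclideanSpace ℝ (Fin n) |
            Metric.infDist y {z : EuclideanSpace ℝ (Fin n) | ∀ i, ∃ m : ℤ, z i = (m : ℝ)} ≤ ε}).toReal)
      atTop
      (𝓝 (ε ^ n * (volume (Metric.ball (0 : EuclideanSpace ℝ (Fin n)) 1)).toReal)) := by
  have h := ProbabilityMeasure.tendsto_measure_of_null_frontier_of_tendsto'
    (tendsto_map_torusMk_sphereUniform hn x)
    (volume_frontier_torusMk_image_closedBall hε.1 hε.2)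
  have hA : MeasurableSet (torusMk '' Metric.closedBall (0 : EuclideanSpace ℝ (Fin n)) ε) :=
    ((isCompact_closedBall _ _).image continuous_torusMk).measurableSet
  simp only [ProbabilityMeasure.coe_mk, volume_torusMk_image_closedBall hε.1.le hε.2,
    Measure.map_apply continuous_torusMk.measurable hA, torusMk_preimage_image_closedBall] at h
  have h' := (ENNReal.tendsto_toReal
    (ENNReal.mul_ne_top ENNReal.ofReal_ne_top measure_ball_lt_top.ne)).comp h
  rwa [ENNReal.toReal_mul, ENNReal.toReal_ofReal (pow_nonneg hε.1.le n)] at h'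
end
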